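/- arXiv:1506.01431 — 8 statements merged into one kernel-verified Lean document; each statement's English description precedes it below -/
import Mathlib

section
/- Fix an integer k ≥ 1 and let N_k and the set S of P-positions be defined by the palace recursion. Define M_k : ℤ × ℤ → ℤ by M_k(x,y) = k if x < 0 and y < 0; M_k(x,y) = 0 if exactly one of x, y is negative; and M_k(x,y) = N_k(x,y) − k if x ≥ 0 and y ≥ 0. Then for all integers x, y ≥ 0: M_k(x,y) = M_k(x−2,y−2) − M_k(x−1,y−2) − M_k(x−2,y−1) + M_k(x,y−1) + M_k(x−1,y) + 3·χ(x−2,y−2) − 2·χ(x−1,y−2) − 2·χ(x−2,y−1) − χ(x−1,y−1) + χ(x,y−1) + χ(x−1,y), where χ(p) = 1 if M_k(p) < 0 and χ(p) = 0 otherwise. Moreover, for x, y ≥ 0, (x,y) ∈ S if and only if M_k(x,y) < 0. -/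
/-- The palace number `N_k(x,y)` of `k`-Blocking Wythoff Nim: the number of
P-positions among the options of `(x,y)`, namely the positions `(x', y)` with
`x' < x`, the positions `(x, y')` with `y' < y`, and the positions
`(x - d, y - d)` with `1 ≤ d ≤ min x y`; a position is a P-position iff its
palace number is `< k`. -/
def palaceNum (k : ℕ) : ℕ × ℕ → ℕ
  | (x, y) =>
    ((Finset.range x).attach.filter (fun x' => palaceNum k (x'.1, y) < k)).card +
    ((Finset.range y).attach.filter (fun y' => palaceNum k (x, y'.1) < k)).card +
    ((Finset.Icc 1 (min x y)).attach.filter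
      (fun d => palaceNum k (x - d.1, y - d.1) < k)).card
  termination_by p => p.1 + p.2
  decreasing_by
  all_goals {
    first
    | (have h := Finset.mem_range.mp x'.2; omega)
    | (have h := Finset.mem_range.mp y'.2; omega)
    | (have h := Finset.mem_range.mp a.2; omega)
    | (have h := Finset.mem_Icc.mp d.2; rw [le_inf_iff] at h; omega)
    | (have h := Finset.mem_Icc.mp a.2; rw [le_inf_iff] at h; omega)
  }

/-- The set of P-positions of `k`-Blocking Wythoff Nim. -/
def pPos (k : ℕ) : Set (ℕ × ℕ) := {p | palaceNum k p < k}

/-- The state of the cellular automaton at position `p ∈ ℤ × ℤ`: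
`k` on the quadrant opposite the game quadrant, `0` on the other two
quadrants outside the game quadrant, and the palace number minus `k` on the
game quadrant. -/
def caState (k : ℕ) (p : ℤ × ℤ) : ℤ :=
  if p.1 < 0 ∧ p.2 < 0 then (k : ℤ)
  else if p.1 < 0 ∨ p.2 < 0 then 0
  else (palaceNum k (p.1.toNat, p.2.toNat) : ℤ) - (k : ℤ)

/-- The palace indicator `χ`: `1` at positions with negative CA state, else `0`. -/
def caNeg (k : ℕ) (p : ℤ × ℤ) : ℤ := if caState k p < 0 then 1 else 0

/-- The indicator of the P-positions on the game quadrant. -/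
def pInd (k x y : ℕ) : ℤ := if palaceNum k (x, y) < k then 1 else 0

/-- The number of P-positions among the diagonal options of `(x, y)`. -/
def diagCount (k x y : ℕ) : ℤ :=
  ∑ d ∈ Finset.Icc 1 (min x y), pInd k (x - d) (y - d)

theorem card_attach_filter_eq_sum {α : Type*} (s : Finset α) (p : α → Prop) [DecidablePred p] :
    ((s.attach.filter (fun a => p a.1)).card : ℤ) = ∑ a ∈ s, if p a then 1 else 0 := by
  rw [Finset.card_filter, Nat.cast_sum, ← Finset.sum_attach s]
  simp

theorem palaceNum_eq (k x y : ℕ) :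
    (palaceNum k (x, y) : ℤ) =
      ∑ i ∈ Finset.range x, pInd k i y + ∑ j ∈ Finset.range y, pInd k x j + diagCount k x y := by
  rw [palaceNum]
  push_cast
  rw [card_attach_filter_eq_sum _ (fun i => palaceNum k (i, y) < k),
    card_attach_filter_eq_sum _ (fun j => palaceNum k (x, j) < k),
    card_attach_filter_eq_sum _ (fun d => palaceNum k (x - d, y - d) < k)]
  rfl

theorem diagCount_zero_left (k y : ℕ) : diagCount k 0 y = 0 := by simp [diagCount]

theorem diagCount_zero_right (k x : ℕ) : diagCount k x 0 = 0 := by simp [diagCount]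

theorem diagCount_succ_succ (k x y : ℕ) :
    diagCount k (x + 1) (y + 1) = diagCount k x y + pInd k x y := by
  have h (n : ℕ) : Finset.Icc 1 n = Finset.Ico 1 (n + 1) := rfl
  simp only [diagCount, h, Finset.sum_Ico_eq_sum_range, Nat.add_min_add_right,
    Nat.add_sub_cancel]
  rw [Finset.sum_range_succ']
  simp only [add_zero, Nat.add_sub_cancel]
  congr 1
  refine Finset.sum_congr rfl fun d _ => ?_
  congr 1 <;> omega

theorem caState_natCast (k x y : ℕ) : caState k (x, y) = palaceNum k (x, y) - k := by
  simp [caState, not_lt.mpr (Int.natCast_nonneg _)]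

theorem caState_of_neg_of_neg (k : ℕ) {x y : ℤ} (hx : x < 0) (hy : y < 0) :
    caState k (x, y) = k := by
  simp [caState, hx, hy]

theorem caState_of_neg_left (k : ℕ) {x : ℤ} (y : ℕ) (hx : x < 0) : caState k (x, y) = 0 := by
  simp [caState, hx]

theorem caState_of_neg_right (k x : ℕ) {y : ℤ} (hy : y < 0) : caState k (x, y) = 0 := by
  simp [caState, hy]

theorem caNeg_natCast (k x y : ℕ) : caNeg k (x, y) = pInd k x y := by
  simp [caNeg, pInd, caState_natCast]

theorem caNeg_of_neg (k : ℕ) {x y : ℤ} (h : x < 0 ∨ y < 0) : caNeg k (x, y) = 0 := by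
  have : 0 ≤ caState k (x, y) := by
    unfold caState
    split_ifs <;> simp_all
  simp [caNeg, this.not_gt]

/-- Theorem 1 of the paper: started from the stated initial condition, the
fourth-order CA rule with palace compensation terms computes `N_k - k` on the
game quadrant, and the P-positions are exactly the positions with negative
CA state. -/
theorem ca_computes_blocking_wythoff (k : ℕ) (hk : 1 ≤ k) :
    (∀ x y : ℤ, 0 ≤ x → 0 ≤ y →
      caState k (x, y) =
        caState k (x - 2, y - 2) - caState k (x - 1, y - 2)
          - caState k (x - 2, y - 1) + caState k (x, y - 1) + caState k (x - 1, y)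
          + 3 * caNeg k (x - 2, y - 2) - 2 * caNeg k (x - 1, y - 2)
          - 2 * caNeg k (x - 2, y - 1) - caNeg k (x - 1, y - 1)
          + caNeg k (x, y - 1) + caNeg k (x - 1, y)) ∧
    (∀ x y : ℕ, (x, y) ∈ pPos k ↔ caState k ((x : ℤ), (y : ℤ)) < 0) := by
  refine ⟨fun x y hx hy => ?_, fun x y => by simp [pPos, caState_natCast]⟩
  lift x to ℕ using hx
  lift y to ℕ using hy
  have sub_one (n : ℕ) : ((n + 1 : ℕ) : ℤ) - 1 = n := by omega
  have sub_two (n : ℕ) : ((n + 2 : ℕ) : ℤ) - 2 = n := by omega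
  have neg_one : ((0 : ℕ) : ℤ) - 1 < 0 := by decide
  have neg_two : ((0 : ℕ) : ℤ) - 2 < 0 := by decide
  have one_sub_two : ((1 : ℕ) : ℤ) - 2 < 0 := by decide
  rcases x with _ | _ | x <;> rcases y with _ | _ | y <;>
    simp only [zero_add, add_assoc, Nat.reduceAdd, sub_one, sub_two,
      caState_of_neg_of_neg, caState_of_neg_left, caState_of_neg_right, caState_natCast,
      caNeg_of_neg, caNeg_natCast, neg_one, neg_two, one_sub_two, true_or, or_true, palaceNum_eq,
      Finset.sum_range_succ, Finset.sum_range_zero, diagCount_succ_succ,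
      diagCount_zero_left, diagCount_zero_right] <;>
    ring
end

section
/- Fix an integer k ≥ 1 and let N_k and the palace indicator π (π(x,y) = 1 if N_k(x,y) < k, else 0) be defined by the palace recursion. Then for all natural numbers x, y with x ≥ 2 and y ≥ 2, the following identity holds in ℤ: N_k(x,y) = N_k(x−2,y−2) − N_k(x−1,y−2) − N_k(x−2,y−1) + N_k(x,y−1) + N_k(x−1,y) + 3·π(x−2,y−2) − 2·π(x−1,y−2) − 2·π(x−2,y−1) − π(x−1,y−1) + π(x,y−1) + π(x−1,y). -/
/-- The palace indicator `π`: `1` at P-positions, else `0` (as an integer). -/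
def palaceInd (k : ℕ) (p : ℕ × ℕ) : ℤ := if palaceNum k p < k then 1 else 0

/-- The palace number as a sum of palace indicators along the three lines of options. -/
theorem palaceNum_eq_sums (k x y : ℕ) :
    (palaceNum k (x, y) : ℤ) =
      ∑ i ∈ Finset.range x, palaceInd k (i, y) + ∑ j ∈ Finset.range y, palaceInd k (x, j) +
        ∑ d ∈ Finset.Icc 1 (min x y), palaceInd k (x - d, y - d) := by
  have card_attach (s : Finset ℕ) (f : ℕ → ℕ × ℕ) :
      ((s.attach.filter (fun i => palaceNum k (f i.1) < k)).card : ℤ) =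
        ∑ i ∈ s, palaceInd k (f i) := by
    rw [Finset.card_filter, ← Finset.sum_attach s]
    push_cast
    rfl
  rw [palaceNum]
  push_cast
  rw [← card_attach _ (fun i => (i, y)), ← card_attach _ (fun j => (x, j)),
    ← card_attach _ (fun d => (x - d, y - d))]

/-- Moving one step up a diagonal adds the value at the previous cell to the diagonal sum. -/
theorem diagSum_succ_succ {M : Type*} [AddCommMonoid M] (f : ℕ × ℕ → M) (x y : ℕ) :
    ∑ d ∈ Finset.Icc 1 (min (x + 1) (y + 1)), f (x + 1 - d, y + 1 - d) =
      ∑ d ∈ Finset.Icc 1 (min x y), f (x - d, y - d) + f (x, y) := by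
  simp only [← Finset.Ico_add_one_right_eq_Icc, Finset.sum_Ico_eq_sum_range,
    Nat.add_sub_cancel, Nat.add_min_add_right]
  rw [Finset.sum_range_succ']
  simp [add_comm 1, Nat.add_sub_add_right]

/-- The interior case of the CA recurrence of Theorem 1: for `x, y ≥ 2`, the
palace number satisfies the fourth-order recurrence with palace compensation
terms `3, -2, -2, -1, 1, 1`. -/
theorem palaceNum_interior_recurrence (k : ℕ) (hk : 1 ≤ k) (x y : ℕ)
    (hx : 2 ≤ x) (hy : 2 ≤ y) :
    (palaceNum k (x, y) : ℤ) =
      (palaceNum k (x - 2, y - 2) : ℤ) - (palaceNum k (x - 1, y - 2) : ℤ)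
        - (palaceNum k (x - 2, y - 1) : ℤ) + (palaceNum k (x, y - 1) : ℤ)
        + (palaceNum k (x - 1, y) : ℤ)
        + 3 * palaceInd k (x - 2, y - 2) - 2 * palaceInd k (x - 1, y - 2)
        - 2 * palaceInd k (x - 2, y - 1) - palaceInd k (x - 1, y - 1)
        + palaceInd k (x, y - 1) + palaceInd k (x - 1, y) := by
  obtain ⟨a, rfl⟩ := Nat.exists_eq_add_of_le' hx
  obtain ⟨b, rfl⟩ := Nat.exists_eq_add_of_le' hy
  simp only [Nat.add_sub_cancel, show a + 2 - 1 = a + 1 from rfl,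
    show b + 2 - 1 = b + 1 from rfl, palaceNum_eq_sums]
  have hdiag := diagSum_succ_succ (palaceInd k)
  have h₁ := hdiag (a + 1) (b + 1)
  have h₂ := hdiag a b
  have h₃ := hdiag (a + 1) b
  have h₄ := hdiag a (b + 1)
  simp only [add_assoc, Nat.reduceAdd] at h₁ h₂ h₃ h₄
  simp only [Finset.sum_range_succ]
  linarith
end

section
/- Fix an integer k ≥ 1 and let N_k be the palace number function of the palace recursion. If (x,y) ∈ ℕ × ℕ satisfies max(x,y) + 2·min(x,y) ≤ k, then N_k(x,y) = max(x,y) + 2·min(x,y) (equivalently, N_k(x,y) = x + y + min(x,y)). -/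
/-- In the hood every option of a position is a P-position, so the palace number
counts all options. -/
theorem palaceNum_eq_add_add_min (k x y : ℕ) (h : x + y + min x y ≤ k) :
    palaceNum k (x, y) = x + y + min x y := by
  rw [palaceNum, Finset.filter_true_of_mem, Finset.filter_true_of_mem,
    Finset.filter_true_of_mem]
  · simp
  · rintro ⟨d, hd⟩ -
    have hd' := Finset.mem_Icc.mp hd
    rw [palaceNum_eq_add_add_min k (x - d) (y - d) (by omega)]
    omega
  · rintro ⟨y', hy⟩ -
    have hy' := Finset.mem_range.mp hy
    rw [palaceNum_eq_add_add_min k x y' (by omega)]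
    omega
  · rintro ⟨x', hx⟩ -
    have hx' := Finset.mem_range.mp hx
    rw [palaceNum_eq_add_add_min k x' y (by omega)]
    omega
  termination_by x + y

/-- In the hood, the region `max x y + 2 * min x y ≤ k`, the palace number is
exactly `max x y + 2 * min x y = x + y + min x y`. -/
theorem palaceNum_in_hood (k : ℕ) (hk : 1 ≤ k) (x y : ℕ)
    (h : max x y + 2 * min x y ≤ k) :
    palaceNum k (x, y) = max x y + 2 * min x y ∧
      palaceNum k (x, y) = x + y + min x y := by
  have := palaceNum_eq_add_add_min k x y (by omega)
  omega
end

section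
/- Fix an integer k ≥ 1 and let S be the set of P-positions of the palace recursion. If (x,y) ∈ ℕ × ℕ satisfies max(x,y) + 2·min(x,y) < k, then (x,y) ∈ S; and if max(x,y) + 2·min(x,y) = k, then (x,y) ∉ S. -/
lemma palaceNum_le (k x y : ℕ) : palaceNum k (x, y) ≤ max x y + 2 * min x y := by
  rw [palaceNum]
  have h₁ := Finset.card_filter_le (Finset.range x).attach
    (fun x' => palaceNum k (x'.1, y) < k)
  have h₂ := Finset.card_filter_le (Finset.range y).attach
    (fun y' => palaceNum k (x, y'.1) < k)
  have h₃ := Finset.card_filter_le (Finset.Icc 1 (min x y)).attach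
    (fun d => palaceNum k (x - d.1, y - d.1) < k)
  simp only [Finset.card_attach, Finset.card_range, Nat.card_Icc] at h₁ h₂ h₃
  omega

lemma palaceNum_eq_of_le (k x y : ℕ) (h : max x y + 2 * min x y ≤ k) :
    palaceNum k (x, y) = max x y + 2 * min x y := by
  rw [palaceNum, Finset.filter_true_of_mem, Finset.filter_true_of_mem,
    Finset.filter_true_of_mem]
  · simp only [Finset.card_attach, Finset.card_range, Nat.card_Icc]
    omega
  · rintro ⟨d, hd⟩ -
    have hd := Finset.mem_Icc.mp hd
    have := palaceNum_le k (x - d) (y - d)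
    dsimp only
    omega
  · rintro ⟨y', hy⟩ -
    have hy := Finset.mem_range.mp hy
    have := palaceNum_le k x y'
    dsimp only
    omega
  · rintro ⟨x', hx⟩ -
    have hx := Finset.mem_range.mp hx
    have := palaceNum_le k x' y
    dsimp only
    omega

/-- The hood interior consists of P-positions, while the casing
`max x y + 2 * min x y = k` consists of N-positions. -/
theorem hood_interior_pPos_casing_not (k : ℕ) (hk : 1 ≤ k) (x y : ℕ) :
    (max x y + 2 * min x y < k → (x, y) ∈ pPos k) ∧
    (max x y + 2 * min x y = k → (x, y) ∉ pPos k) := by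
  constructor
  · exact fun h => (palaceNum_le k x y).trans_lt h
  · intro h hmem
    have hlt : palaceNum k (x, y) < k := hmem
    rw [palaceNum_eq_of_le k x y h.le] at hlt
    omega
end

section
/- Fix an integer k ≥ 1 and let N_k be the palace number function of the palace recursion. Then for every natural number m with m ≤ k, there exists (x,y) ∈ ℕ × ℕ with N_k(x,y) = m. -/
/-- Along the edge `x = 0` the palace number of `(0, m)` is `m`, as long as `m ≤ k`. -/
theorem palaceNum_zero_left (k m : ℕ) (hm : m ≤ k) : palaceNum k (0, m) = m := by
  induction m using Nat.strong_induction_on with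
  | _ m ih =>
    have hcol : ∀ y' ∈ (Finset.range m).attach, palaceNum k (0, y'.1) < k := by
      intro y' _
      have hlt := Finset.mem_range.mp y'.2
      rw [ih y' hlt (by omega)]
      omega
    have hdiag : (Finset.Icc 1 (min 0 m)).attach = ∅ := by
      rw [Finset.attach_eq_empty_iff]
      simp
    have hrow : (Finset.range 0).attach = ∅ := rfl
    rw [palaceNum, Finset.filter_true_of_mem hcol, hdiag, hrow, Finset.filter_empty,
      Finset.filter_empty, Finset.card_empty, Finset.card_empty, Finset.card_attach,
      Finset.card_range, zero_add, add_zero]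

/-- Every value from `0` up to `k` is attained as a palace number. -/
theorem palaceNum_surj_up_to_k (k : ℕ) (hk : 1 ≤ k) :
    ∀ m : ℕ, m ≤ k → ∃ p : ℕ × ℕ, palaceNum k p = m := by
  exact fun m hm => ⟨(0, m), palaceNum_zero_left k m hm⟩
end

section
/- For all integers b, c, d, e, f, g, there exists an integer a such that g = a − b − c + e + f + 3·neg(a) − 2·neg(b) − 2·neg(c) − neg(d) + neg(e) + neg(f), where neg : ℤ → ℤ is defined by neg(t) = 1 if t < 0 and neg(t) = 0 otherwise. In other words, the local rule of the cellular automaton can always be run in reverse: there is no Garden-of-Eden pattern for the local update. -/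
/-- `neg t` is `1` if the state `t` is negative (a palace), and `0` otherwise. -/
def caIndicator (t : ℤ) : ℤ := if t < 0 then 1 else 0

theorem add_three_mul_caIndicator_surjective :
    Function.Surjective fun a : ℤ => a + 3 * caIndicator a := by
  intro s
  rcases lt_or_ge s 0 with hs | hs
  · exact ⟨s - 3, by simp [caIndicator, show s - 3 < 0 by lia]⟩
  · exact ⟨s, by simp [caIndicator, hs.not_gt]⟩

/-- The local rule of the CA can always be run in reverse: for any values
`b, c, d, e, f, g` there is an integer `a` satisfying the forward rule; there
is no Garden-of-Eden pattern for the local update. -/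
theorem ca_local_rule_reversible (b c d e f g : ℤ) :
    ∃ a : ℤ, g = a - b - c + e + f
      + 3 * caIndicator a - 2 * caIndicator b - 2 * caIndicator c
      - caIndicator d + caIndicator e + caIndicator f := by
  obtain ⟨a, ha⟩ := add_three_mul_caIndicator_surjective
    (g + b + c - e - f + 2 * caIndicator b + 2 * caIndicator c
      + caIndicator d - caIndicator e - caIndicator f)
  exact ⟨a, by linarith⟩
end

section
/- Let b, c, d, e, f, g be integers, let neg : ℤ → ℤ be neg(t) = 1 if t < 0 and 0 otherwise, and set r = g + b + c − e − f + 2·neg(b) + 2·neg(c) + neg(d) − neg(e) − neg(f). Then an integer a satisfies the forward rule g = a − b − c + e + f + 3·neg(a) − 2·neg(b) − 2·neg(c) − neg(d) + neg(e) + neg(f) if and only if (a = r and r ≥ 0) or (a = r − 3 and r ≤ 2). Consequently: if r ≥ 3 then a = r is the unique solution; if r < 0 then a = r − 3 is the unique solution; and if r ∈ {0, 1, 2} then there are exactly two solutions, namely a = r and a = r − 3. -/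
/-- Characterization of the reversed CA rule: with
`r = g + b + c - e - f + 2·neg b + 2·neg c + neg d - neg e - neg f`,
the solutions `a` of the forward rule are exactly `a = r` (when `r ≥ 0`) and
`a = r - 3` (when `r ≤ 2`); so there is a unique solution when `r ≥ 3` or
`r < 0`, and exactly the two solutions `r` and `r - 3` when `r ∈ {0, 1, 2}`. -/
theorem ca_reverse_rule_characterization (b c d e f g : ℤ)
    (r : ℤ)
    (hr : r = g + b + c - e - f + 2 * caIndicator b + 2 * caIndicator c
      + caIndicator d - caIndicator e - caIndicator f) :
    (∀ a : ℤ,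
      (g = a - b - c + e + f
        + 3 * caIndicator a - 2 * caIndicator b - 2 * caIndicator c
        - caIndicator d + caIndicator e + caIndicator f) ↔
      ((a = r ∧ 0 ≤ r) ∨ (a = r - 3 ∧ r ≤ 2))) ∧
    (3 ≤ r → ∀ a : ℤ,
      (g = a - b - c + e + f
        + 3 * caIndicator a - 2 * caIndicator b - 2 * caIndicator c
        - caIndicator d + caIndicator e + caIndicator f) ↔ a = r) ∧
    (r < 0 → ∀ a : ℤ,
      (g = a - b - c + e + f
        + 3 * caIndicator a - 2 * caIndicator b - 2 * caIndicator c
        - caIndicator d + caIndicator e + caIndicator f) ↔ a = r - 3) ∧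
    (0 ≤ r → r ≤ 2 → ∀ a : ℤ,
      (g = a - b - c + e + f
        + 3 * caIndicator a - 2 * caIndicator b - 2 * caIndicator c
        - caIndicator d + caIndicator e + caIndicator f) ↔
      (a = r ∨ a = r - 3)) := by
  have caIndicator_cases (a : ℤ) :
      (a < 0 ∧ caIndicator a = 1) ∨ (0 ≤ a ∧ caIndicator a = 0) := by
    unfold caIndicator
    split_ifs <;> omega
  refine ⟨fun a => ?_, fun _ a => ?_, fun _ a => ?_, fun _ _ a => ?_⟩ <;>
    have := caIndicator_cases a <;> omega
end

section
/- Let S be the set of P-positions of the palace recursion with blocking parameter k = 1 (classical Wythoff Nim), and let φ = (1 + √5)/2 be the golden ratio. Then S = { (⌊n·φ⌋, ⌊n·φ²⌋) : n ∈ ℕ } ∪ { (⌊n·φ²⌋, ⌊n·φ⌋) : n ∈ ℕ }. -/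
/-- A position is a P-position of Wythoff Nim iff none of its options is. -/
theorem mem_pPos_one_iff (x y : ℕ) :
    (x, y) ∈ pPos 1 ↔
      (∀ x' < x, (x', y) ∉ pPos 1) ∧ (∀ y' < y, (x, y') ∉ pPos 1) ∧
        ∀ d, 1 ≤ d → d ≤ x → d ≤ y → (x - d, y - d) ∉ pPos 1 := by
  simp only [pPos, Set.mem_ofPred_eq]
  conv_lhs => rw [palaceNum]
  simp only [Nat.lt_one_iff, Nat.add_eq_zero_iff, Finset.card_eq_zero, Finset.filter_eq_empty_iff,
    Finset.mem_attach, true_imp_iff, Subtype.forall, Finset.mem_range, Finset.mem_Icc, le_inf_iff,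
    and_imp, and_assoc]

/-- The normal-play recursion determines the set of P-positions: a set which no move connects
to itself, and which every position outside it can reach in one move, is `pPos 1`. -/
theorem mem_pPos_one_iff_of_kernel (W : ℕ → ℕ → Prop)
    (hleft : ∀ x y, W x y → ∀ x' < x, ¬ W x' y)
    (hright : ∀ x y, W x y → ∀ y' < y, ¬ W x y')
    (hdiag : ∀ x y, W x y → ∀ d, 1 ≤ d → d ≤ x → d ≤ y → ¬ W (x - d) (y - d))
    (hreach : ∀ x y, ¬ W x y → (∃ x' < x, W x' y) ∨ (∃ y' < y, W x y') ∨
      ∃ d, 1 ≤ d ∧ d ≤ x ∧ d ≤ y ∧ W (x - d) (y - d))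
    (x y : ℕ) : (x, y) ∈ pPos 1 ↔ W x y := by
  induction hs : x + y using Nat.strong_induction_on generalizing x y with
  | _ s ih =>
    have ih' : ∀ x' y', x' + y' < x + y → ((x', y') ∈ pPos 1 ↔ W x' y') :=
      fun x' y' h => ih (x' + y') (hs ▸ h) x' y' rfl
    rw [mem_pPos_one_iff]
    constructor
    · rintro ⟨h₁, h₂, h₃⟩
      by_contra hW
      rcases hreach x y hW with ⟨x', hx, h⟩ | ⟨y', hy, h⟩ | ⟨d, hd, hdx, hdy, h⟩
      · exact h₁ x' hx ((ih' _ _ (by omega)).2 h)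
      · exact h₂ y' hy ((ih' _ _ (by omega)).2 h)
      · exact h₃ d hd hdx hdy ((ih' _ _ (by omega)).2 h)
    · intro hW
      refine ⟨fun x' hx h => ?_, fun y' hy h => ?_, fun d hd hdx hdy h => ?_⟩
      · exact hleft x y hW x' hx ((ih' _ _ (by omega)).1 h)
      · exact hright x y hW y' hy ((ih' _ _ (by omega)).1 h)
      · exact hdiag x y hW d hd hdx hdy ((ih' _ _ (by omega)).1 h)

/-- If `A` is strictly increasing with `A 0 = 0`, and the values `A n` and `A n + n` for `n > 0`
partition the positive integers, then the pairs `(A n, A n + n)` and their mirror images are the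
P-positions of Wythoff Nim. -/
theorem mem_pPos_one_iff_of_complementary {A : ℕ → ℕ} (hA : StrictMono A) (hA₀ : A 0 = 0)
    (hcover : ∀ m, ∃ n, m = A n ∨ m = A n + n)
    (hdisj : ∀ i j, A i = A j + j → i = 0 ∧ j = 0) (x y : ℕ) :
    (x, y) ∈ pPos 1 ↔ ∃ n, (x = A n ∧ y = A n + n) ∨ (x = A n + n ∧ y = A n) := by
  set W : ℕ → ℕ → Prop := fun x y => ∃ n, (x = A n ∧ y = A n + n) ∨ (x = A n + n ∧ y = A n)
  have hsymm : ∀ x y, W x y → W y x := by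
    rintro x y ⟨n, h⟩
    exact ⟨n, by omega⟩
  have hright : ∀ x y, W x y → ∀ y' < y, ¬ W x y' := by
    rintro x y ⟨n, hn⟩ y' hy ⟨m, hm⟩
    have h₁ := hdisj n m
    have h₂ := hdisj m n
    rcases lt_trichotomy n m with h | rfl | h
    · have := hA h
      omega
    · omega
    · have := hA h
      omega
  have hreach : ∀ x y, x ≤ y → ¬ W x y → (∃ y' < y, W x y') ∨
      ∃ d, 1 ≤ d ∧ d ≤ x ∧ d ≤ y ∧ W (x - d) (y - d) := by
    intro x y hxy hW
    obtain ⟨n, rfl | rfl⟩ := hcover x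
    · rcases lt_trichotomy y (A n + n) with h | rfl | h
      · have hlt : A (y - A n) < A n := hA (by omega)
        exact Or.inr ⟨A n - A (y - A n), by omega, by omega, by omega, y - A n, by omega⟩
      · exact absurd ⟨n, by omega⟩ hW
      · exact Or.inl ⟨A n + n, h, n, by omega⟩
    · rcases Nat.eq_zero_or_pos n with rfl | hn
      · have : y ≠ 0 := fun h => hW ⟨0, by omega⟩
        exact Or.inl ⟨0, by omega, 0, by omega⟩
      · exact Or.inl ⟨A n, by omega, n, by omega⟩
  refine mem_pPos_one_iff_of_kernel W ?_ hright ?_ ?_ x y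
  · exact fun x y h x' hx h' => hright y x (hsymm _ _ h) x' hx (hsymm _ _ h')
  · rintro x y ⟨n, hn⟩ d hd hdx hdy ⟨m, hm⟩
    obtain rfl : n = m := by omega
    omega
  · intro x y hW
    rcases le_total x y with h | h
    · exact Or.inr (hreach x y h hW)
    · rcases hreach y x h (fun h' => hW (hsymm _ _ h')) with ⟨x', hx, h'⟩ | ⟨d, hd, hdy, hdx, h'⟩
      · exact Or.inl ⟨x', hx, hsymm _ _ h'⟩
      · exact Or.inr (Or.inr ⟨d, hd, hdx, hdy, hsymm _ _ h'⟩)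

open Real in
theorem natFloor_mul_goldenRatio_sq (n : ℕ) :
    ⌊(n : ℝ) * goldenRatio ^ 2⌋₊ = ⌊(n : ℝ) * goldenRatio⌋₊ + n := by
  rw [goldenRatio_sq, mul_add, mul_one, Nat.floor_add_natCast]
  have := goldenRatio_pos
  positivity

open Real in
theorem strictMono_natFloor_mul_goldenRatio :
    StrictMono fun n : ℕ => ⌊(n : ℝ) * goldenRatio⌋₊ := by
  have hφ := one_lt_goldenRatio
  refine strictMono_nat_of_lt_succ fun n => ?_
  rw [Nat.lt_iff_add_one_le, ← Nat.floor_add_one (by positivity)]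
  refine Nat.floor_le_floor ?_
  push_cast
  linarith

open Real in
theorem goldenRatio_holderConjugate_sq : goldenRatio.HolderConjugate (goldenRatio ^ 2) := by
  rw [holderConjugate_iff]
  refine ⟨one_lt_goldenRatio, ?_⟩
  have h : goldenRatio * goldenRatio⁻¹ = 1 := mul_inv_cancel₀ goldenRatio_ne_zero
  rw [← inv_pow]
  linear_combination (goldenRatio * goldenRatio⁻¹ + 1 - goldenRatio⁻¹) * h -
    goldenRatio⁻¹ ^ 2 * goldenRatio_sq

theorem natCast_natFloor_eq_beattySeq {r : ℝ} (hr : 0 ≤ r) (n : ℕ) :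
    ((⌊(n : ℝ) * r⌋₊ : ℕ) : ℤ) = beattySeq r n := by
  rw [beattySeq, Int.cast_natCast, Int.natCast_floor_eq_floor (by positivity)]

theorem natCast_mem_beattySeq_pos_iff {r : ℝ} (hr : 0 ≤ r) (m : ℕ) :
    (m : ℤ) ∈ {beattySeq r k | k > 0} ↔ ∃ n : ℕ, 0 < n ∧ m = ⌊(n : ℝ) * r⌋₊ := by
  constructor
  · rintro ⟨k, hk, h⟩
    lift k to ℕ using hk.le
    rw [← natCast_natFloor_eq_beattySeq hr] at h
    exact ⟨k, by exact_mod_cast hk, by exact_mod_cast h.symm⟩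
  · rintro ⟨n, hn, rfl⟩
    exact ⟨n, by exact_mod_cast hn, (natCast_natFloor_eq_beattySeq hr n).symm⟩

open Real in
theorem pos_iff_xor_natFloor_mul_goldenRatio (m : ℕ) :
    0 < m ↔ Xor (∃ n : ℕ, 0 < n ∧ m = ⌊(n : ℝ) * goldenRatio⌋₊)
      (∃ n : ℕ, 0 < n ∧ m = ⌊(n : ℝ) * goldenRatio⌋₊ + n) := by
  have h := Set.ext_iff.1 (goldenRatio_irrational.beattySeq_symmDiff_beattySeq_pos
    goldenRatio_holderConjugate_sq) m
  rw [Set.mem_symmDiff, natCast_mem_beattySeq_pos_iff goldenRatio_pos.le,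
    natCast_mem_beattySeq_pos_iff (by positivity)] at h
  simp only [natFloor_mul_goldenRatio_sq, Set.mem_ofPred_eq, Nat.cast_pos] at h
  exact h.symm

/-- For `k = 1` (classical Wythoff Nim), the P-positions are given by the
Beatty sequences of the golden ratio `φ = (1 + √5)/2` and of `φ²`. -/
theorem pPos_one_eq_wythoff_beatty :
    pPos 1 =
      {p : ℕ × ℕ | ∃ n : ℕ,
          p = (⌊(n : ℝ) * ((1 + Real.sqrt 5) / 2)⌋₊,
               ⌊(n : ℝ) * ((1 + Real.sqrt 5) / 2) ^ 2⌋₊)} ∪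
      {p : ℕ × ℕ | ∃ n : ℕ,
          p = (⌊(n : ℝ) * ((1 + Real.sqrt 5) / 2) ^ 2⌋₊,
               ⌊(n : ℝ) * ((1 + Real.sqrt 5) / 2)⌋₊)} := by
  ext ⟨x, y⟩
  rw [show (1 + √5) / 2 = Real.goldenRatio from rfl]
  have hA := strictMono_natFloor_mul_goldenRatio
  rw [mem_pPos_one_iff_of_complementary hA (by simp) ?_ ?_]
  · simp only [natFloor_mul_goldenRatio_sq, Set.mem_union, Set.mem_ofPred_eq, Prod.mk.injEq,
      exists_or]
  · intro m
    rcases Nat.eq_zero_or_pos m with rfl | hm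
    · exact ⟨0, by simp⟩
    · rcases (pos_iff_xor_natFloor_mul_goldenRatio m).1 hm with ⟨⟨n, -, h⟩, -⟩ | ⟨⟨n, -, h⟩, -⟩
      · exact ⟨n, Or.inl h⟩
      · exact ⟨n, Or.inr h⟩
  · intro i j h
    have hi := hA.le_apply (x := i)
    have hj := hA.le_apply (x := j)
    have h₀ : ⌊((0 : ℕ) : ℝ) * Real.goldenRatio⌋₊ = 0 := by simp
    by_contra hij
    have hpos : 0 < i ∧ 0 < j := by
      rcases Nat.eq_zero_or_pos i with rfl | hi'
      · omega
      · rcases Nat.eq_zero_or_pos j with rfl | hj' <;> omega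
    rcases (pos_iff_xor_natFloor_mul_goldenRatio _).1 (hpos.1.trans_le hi) with ⟨-, hn⟩ | ⟨-, hn⟩
    · exact hn ⟨j, hpos.2, h⟩
    · exact hn ⟨i, hpos.1, rfl⟩
end
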